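/- arXiv:2604.00644 — 4 statements merged into one kernel-verified Lean document; each statement's English description precedes it below -/
import Mathlib

section
/- The function Σ ↦ (1/2)‖Σ − S^l‖²_F + (1/2)‖Σ − S^u‖²_F + λ‖Σ‖ − ⟨Λ, Σ − Γ⟩ + (1/(2β))‖Σ − Γ‖²_F, defined on real p×p matrices, attains its minimum uniquely at Σ̂ = (1/(2β+1)) · S(β(S^l + S^u + Λ) + Γ, βλ); that is, for every real p×p matrix Σ ≠ Σ̂ the objective value at Σ is strictly larger than at Σ̂. -/
open Matrix Real

noncomputable section

/-- Frobenius inner product `⟨A, B⟩ = trace(AᵀB)`. -/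
def frobInner {p : ℕ} (A B : Matrix (Fin p) (Fin p) ℝ) : ℝ :=
  ∑ i, ∑ j, A i j * B i j

/-- Squared Frobenius norm. -/
def frobNormSq {p : ℕ} (A : Matrix (Fin p) (Fin p) ℝ) : ℝ :=
  ∑ i, ∑ j, (A i j) ^ 2

/-- Off-diagonal ℓ1 norm `‖A‖ = Σ_{i≠j} |A_{ij}|`. -/
def offDiagL1 {p : ℕ} (A : Matrix (Fin p) (Fin p) ℝ) : ℝ :=
  ∑ i, ∑ j, if i ≠ j then |A i j| else 0

/-- Entrywise soft-thresholding operator: off-diagonal entries are soft-thresholded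
at level `η`, diagonal entries are kept. -/
def softThresh {p : ℕ} (G : Matrix (Fin p) (Fin p) ℝ) (η : ℝ) : Matrix (Fin p) (Fin p) ℝ :=
  Matrix.of fun i j => if i = j then G i j else Real.sign (G i j) * max (|G i j| - η) 0

/-- The Σ-step objective (the augmented Lagrangian as a function of Σ). -/
def sigStepObj {p : ℕ} (Sl Su Lam Gam : Matrix (Fin p) (Fin p) ℝ) (lam β : ℝ)
    (Sig : Matrix (Fin p) (Fin p) ℝ) : ℝ :=
  (1 / 2) * frobNormSq (Sig - Sl) + (1 / 2) * frobNormSq (Sig - Su)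
    + lam * offDiagL1 Sig - frobInner Lam (Sig - Gam) + (1 / (2 * β)) * frobNormSq (Sig - Gam)

/-- The residual of scalar soft-thresholding is a subgradient of `η * |·|`. -/
lemma mul_sub_softThreshold_le {G η k x y : ℝ} (hη : 0 ≤ η) (hk : 0 < k)
    (hy : k * y = Real.sign G * max (|G| - η) 0) :
    (x - y) * (G - k * y) ≤ η * (|x| - |y|) := by
  have hx₁ := mul_le_mul_of_nonneg_left (le_abs_self x) hη
  have hx₂ := mul_le_mul_of_nonneg_left (neg_abs_le x) hη
  rcases le_total |G| η with h | h
  · rw [max_eq_right (by linarith), mul_zero] at hy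
    have hy0 : y = 0 := (mul_eq_zero.mp hy).resolve_left hk.ne'
    subst hy0
    have h₁ : x * G ≤ |x| * |G| := by
      rw [← abs_mul]
      exact le_abs_self _
    have h₂ := mul_le_mul_of_nonneg_left h (abs_nonneg x)
    simp only [sub_zero, mul_zero, abs_zero]
    linarith
  · rw [max_eq_left (by linarith)] at hy
    rcases lt_trichotomy G 0 with hG | hG | hG
    · rw [Real.sign_of_neg hG, abs_of_neg hG] at hy
      rw [abs_of_neg hG] at h
      have hy0 : y ≤ 0 := by
        by_contra! hc
        nlinarith [mul_pos hk hc]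
      rw [abs_of_nonpos hy0, show G - k * y = -η by linarith]
      linarith
    · subst hG
      have hη0 : η = 0 := le_antisymm (by simpa using h) hη
      subst hη0
      rw [hy]
      simp
    · rw [Real.sign_of_pos hG, abs_of_pos hG] at hy
      rw [abs_of_pos hG] at h
      have hy0 : 0 ≤ y := by
        by_contra! hc
        nlinarith [mul_neg_of_pos_of_neg hk hc]
      rw [abs_of_nonneg hy0, show G - k * y = η by linarith]
      linarith

/-- The contribution of one matrix entry to the objective, with `ℓ1` weight `t`. -/
def entryObj (a b L g t β x : ℝ) : ℝ :=
  (1 / 2) * (x - a) ^ 2 + (1 / 2) * (x - b) ^ 2 + t * |x| - L * (x - g)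
    + (1 / (2 * β)) * (x - g) ^ 2

/-- Quadratic growth of the entry objective around a point satisfying the first-order condition. -/
lemma entryObj_add_sq_le {a b L g t β x y : ℝ} (hβ : 0 < β)
    (h : (x - y) * (β * (a + b + L) + g - (2 * β + 1) * y) ≤ β * t * (|x| - |y|)) :
    entryObj a b L g t β y + (x - y) ^ 2 ≤ entryObj a b L g t β x := by
  have key : entryObj a b L g t β x - (entryObj a b L g t β y + (x - y) ^ 2)
      = (1 / (2 * β)) * (x - y) ^ 2
        + (1 / β) * (β * t * (|x| - |y|)
          - (x - y) * (β * (a + b + L) + g - (2 * β + 1) * y)) := by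
    unfold entryObj
    field_simp
    ring
  have h₁ : 0 ≤ (1 / (2 * β)) * (x - y) ^ 2 := by positivity
  have h₂ := mul_nonneg (one_div_pos.mpr hβ).le (sub_nonneg.mpr h)
  linarith

lemma sigStepObj_eq_sum {p : ℕ} (Sl Su Lam Gam : Matrix (Fin p) (Fin p) ℝ) (lam β : ℝ)
    (Sig : Matrix (Fin p) (Fin p) ℝ) :
    sigStepObj Sl Su Lam Gam lam β Sig = ∑ i, ∑ j,
      entryObj (Sl i j) (Su i j) (Lam i j) (Gam i j) (if i ≠ j then lam else 0) β (Sig i j) := by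
  simp only [sigStepObj, frobNormSq, offDiagL1, frobInner, entryObj, Matrix.sub_apply,
    Finset.mul_sum, ← Finset.sum_add_distrib, ← Finset.sum_sub_distrib, mul_ite, ite_mul,
    mul_zero, zero_mul]

/-- The Σ-step of the ADMM algorithm has the closed-form, unique minimizer
`(1/(2β+1)) · S(β(Sˡ + Sᵘ + Λ) + Γ, βλ)`. -/
theorem sigma_step_closed_form {p : ℕ} (Sl Su Lam Gam : Matrix (Fin p) (Fin p) ℝ)
    (lam β : ℝ) (hlam : 0 < lam) (hβ : 0 < β) :
    ∀ Sig : Matrix (Fin p) (Fin p) ℝ,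
      Sig ≠ (1 / (2 * β + 1)) • softThresh (β • (Sl + Su + Lam) + Gam) (β * lam) →
      sigStepObj Sl Su Lam Gam lam β
          ((1 / (2 * β + 1)) • softThresh (β • (Sl + Su + Lam) + Gam) (β * lam))
        < sigStepObj Sl Su Lam Gam lam β Sig := by
  intro Sig hne
  set T := (1 / (2 * β + 1)) • softThresh (β • (Sl + Su + Lam) + Gam) (β * lam) with hT
  have hk : 0 < 2 * β + 1 := by positivity
  have growth (i j : Fin p) :
      entryObj (Sl i j) (Su i j) (Lam i j) (Gam i j) (if i ≠ j then lam else 0) β (T i j)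
          + (Sig i j - T i j) ^ 2
        ≤ entryObj (Sl i j) (Su i j) (Lam i j) (Gam i j) (if i ≠ j then lam else 0) β
          (Sig i j) := by
    apply entryObj_add_sq_le hβ
    have hTij : (2 * β + 1) * T i j
        = softThresh (β • (Sl + Su + Lam) + Gam) (β * lam) i j := by
      rw [hT, Matrix.smul_apply, smul_eq_mul]
      field_simp
    simp only [softThresh, Matrix.of_apply, Matrix.add_apply, Matrix.smul_apply, smul_eq_mul]
      at hTij
    by_cases hij : i = j
    · rw [if_pos hij] at hTij
      rw [hTij, sub_self, mul_zero]
      simp [hij]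
    · simp only [ne_eq, hij, not_false_eq_true, if_true]
      apply mul_sub_softThreshold_le (by positivity) hk
      rwa [if_neg hij] at hTij
  obtain ⟨i₀, j₀, hij⟩ : ∃ i j, Sig i j ≠ T i j := by
    by_contra! h
    exact hne (Matrix.ext h)
  rw [sigStepObj_eq_sum, sigStepObj_eq_sum]
  have growth_le (i j : Fin p) := (le_add_of_nonneg_right (sq_nonneg _)).trans (growth i j)
  refine Finset.sum_lt_sum (fun i _ => Finset.sum_le_sum fun j _ => growth_le i j)
    ⟨i₀, Finset.mem_univ _, Finset.sum_lt_sum (fun j _ => growth_le i₀ j)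
      ⟨j₀, Finset.mem_univ _, ?_⟩⟩
  exact (lt_add_of_pos_right _ (sq_pos_of_ne_zero (sub_ne_zero.mpr hij))).trans_le (growth i₀ j₀)

end
end

section
/- Let G be a symmetric real p×p matrix with spectral decomposition G = Σ_{i=1}^p λ_i v_i v_iᵀ, where v_1, …, v_p are orthonormal eigenvectors with eigenvalues λ_1, …, λ_p, and let ε be a real number. Define G₊ = Σ_{i=1}^p max(λ_i, ε) v_i v_iᵀ. Then G₊ is symmetric with G₊ ⪰ εI, and for every symmetric real p×p matrix Γ with Γ ⪰ εI one has ‖Γ − G‖_F ≥ ‖G₊ − G‖_F; that is, G₊ minimizes ‖Γ − G‖²_F over the convex cone {Γ symmetric : Γ ⪰ εI}. -/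
open Matrix Real

noncomputable section

/-- Frobenius norm. -/
def frobNorm {p : ℕ} (A : Matrix (Fin p) (Fin p) ℝ) : ℝ :=
  Real.sqrt (frobNormSq A)

/-- `Γ ⪰ εI`: `Γ − εI` is positive semidefinite. -/
def PSDge {p : ℕ} (Gam : Matrix (Fin p) (Fin p) ℝ) (ε : ℝ) : Prop :=
  (Gam - ε • (1 : Matrix (Fin p) (Fin p) ℝ)).PosSemidef

theorem sum_smul_vecMulVec_isSymm {ι n : Type*} [Fintype ι] (c : ι → ℝ) (v : ι → n → ℝ) :
    (∑ i, c i • vecMulVec (v i) (v i)).IsSymm := by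
  simp [Matrix.IsSymm, transpose_sum, transpose_vecMulVec]

/-- A full orthonormal system resolves the identity. -/
theorem sum_vecMulVec_eq_one {n : Type*} [Fintype n] [DecidableEq n] (v : n → n → ℝ)
    (horth : ∀ i j, dotProduct (v i) (v j) = if i = j then (1 : ℝ) else 0) :
    ∑ i, vecMulVec (v i) (v i) = 1 := by
  have h : Matrix.of v * (Matrix.of v)ᵀ = 1 := by
    ext i j
    simpa [Matrix.mul_apply, Matrix.one_apply, dotProduct] using horth i j
  rw [← mul_eq_one_comm.mp h]
  ext i j
  simp [Matrix.sum_apply, Matrix.mul_apply, vecMulVec_apply]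

theorem sum_smul_vecMulVec_mulVec {n : Type*} [Fintype n] [DecidableEq n] (c : n → ℝ)
    (v : n → n → ℝ)
    (horth : ∀ i j, dotProduct (v i) (v j) = if i = j then (1 : ℝ) else 0) (k : n) :
    (∑ i, c i • vecMulVec (v i) (v i)) *ᵥ v k = c k • v k := by
  simp [Matrix.sum_mulVec, Matrix.smul_mulVec, vecMulVec_mulVec, horth]

theorem sum_mul_sum_smul_vecMulVec {ι n : Type*} [Fintype ι] [Fintype n] (M : Matrix n n ℝ)
    (c : ι → ℝ) (v : ι → n → ℝ) :
    ∑ j, ∑ k, M j k * (∑ i, c i • vecMulVec (v i) (v i)) j k =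
      ∑ i, c i * (v i ⬝ᵥ M *ᵥ v i) := by
  simp only [Matrix.sum_apply, Matrix.smul_apply, vecMulVec_apply, smul_eq_mul, dotProduct,
    mulVec, Finset.mul_sum]
  simp_rw [Finset.sum_comm (s := Finset.univ (α := n)) (t := Finset.univ (α := ι))]
  refine Finset.sum_congr rfl fun i _ => Finset.sum_congr rfl fun j _ =>
    Finset.sum_congr rfl fun k _ => by ring

/-- A nonnegative inner product with the increment makes the Frobenius norm grow. -/
theorem frobNorm_le_frobNorm_add {p : ℕ} (A B : Matrix (Fin p) (Fin p) ℝ)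
    (h : 0 ≤ ∑ j, ∑ k, A j k * B j k) : frobNorm B ≤ frobNorm (A + B) := by
  refine Real.sqrt_le_sqrt ?_
  have hA : 0 ≤ frobNormSq A :=
    Finset.sum_nonneg fun _ _ => Finset.sum_nonneg fun _ _ => sq_nonneg _
  have hAB : frobNormSq (A + B) =
      frobNormSq A + 2 * (∑ j, ∑ k, A j k * B j k) + frobNormSq B := by
    simp only [frobNormSq, Matrix.add_apply, Finset.mul_sum, ← Finset.sum_add_distrib]
    refine Finset.sum_congr rfl fun j _ => Finset.sum_congr rfl fun k _ => by ring
  linarith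

/-- Eigenvalue truncation `G₊ = Σᵢ max(λᵢ, ε) vᵢvᵢᵀ` is the Frobenius-norm projection of
a symmetric matrix `G = Σᵢ λᵢ vᵢvᵢᵀ` onto the convex cone `{Γ symmetric : Γ ⪰ εI}`. -/
theorem projection_onto_psd_cone {p : ℕ} (G : Matrix (Fin p) (Fin p) ℝ) (hG : G.IsSymm)
    (ε : ℝ) (v : Fin p → Fin p → ℝ) (lam : Fin p → ℝ)
    (horth : ∀ i j, dotProduct (v i) (v j) = if i = j then (1 : ℝ) else 0)
    (hdecomp : G = ∑ i, lam i • vecMulVec (v i) (v i)) :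
    (∑ i, max (lam i) ε • vecMulVec (v i) (v i)).IsSymm ∧
    PSDge (∑ i, max (lam i) ε • vecMulVec (v i) (v i)) ε ∧
    ∀ Gam : Matrix (Fin p) (Fin p) ℝ, Gam.IsSymm → PSDge Gam ε →
      frobNorm ((∑ i, max (lam i) ε • vecMulVec (v i) (v i)) - G) ≤ frobNorm (Gam - G) := by
  have hunit (i : Fin p) : v i ⬝ᵥ v i = 1 := by simp [horth]
  refine ⟨sum_smul_vecMulVec_isSymm _ v, ?_, fun Gam _ hGam => ?_⟩
  · have h : (∑ i, max (lam i) ε • vecMulVec (v i) (v i)) - ε • (1 : Matrix (Fin p) (Fin p) ℝ) =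
        ∑ i, (max (lam i) ε - ε) • vecMulVec (v i) (v i) := by
      simp only [sub_smul, Finset.sum_sub_distrib, ← Finset.smul_sum,
        sum_vecMulVec_eq_one v horth]
    rw [PSDge, h]
    refine Matrix.posSemidef_sum _ fun i _ => ?_
    refine PosSemidef.smul ?_ (sub_nonneg.mpr (le_max_right _ _))
    simpa using Matrix.posSemidef_vecMulVec_self_star (v i)
  · have hquad (i : Fin p) : ε ≤ v i ⬝ᵥ Gam *ᵥ v i := by
      have h := hGam.dotProduct_mulVec_nonneg (v i)
      simp only [star_trivial, sub_mulVec, smul_mulVec, one_mulVec, dotProduct_sub,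
        dotProduct_smul, hunit, smul_eq_mul, mul_one] at h
      linarith
    set Gp := ∑ i, max (lam i) ε • vecMulVec (v i) (v i) with hGp
    have hdiff : Gp - G = ∑ i, (max (lam i) ε - lam i) • vecMulVec (v i) (v i) := by
      simp only [hGp, hdecomp, sub_smul, Finset.sum_sub_distrib]
    rw [← sub_add_sub_cancel Gam Gp G]
    refine frobNorm_le_frobNorm_add _ _ ?_
    rw [hdiff, sum_mul_sum_smul_vecMulVec]
    refine Finset.sum_nonneg fun i _ => ?_
    rw [sub_mulVec, hGp, sum_smul_vecMulVec_mulVec _ v horth, dotProduct_sub, dotProduct_smul,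
      hunit, smul_eq_mul, mul_one]
    rcases le_total (lam i) ε with h | h
    · rw [max_eq_right h]
      exact mul_nonneg (sub_nonneg.mpr h) (sub_nonneg.mpr (hquad i))
    · simp [max_eq_left h]

end
end

section
/- Suppose two pairs (Σ₁, Λ₁) and (Σ₂, Λ₂) of symmetric real p×p matrices each satisfy the stationarity conditions: for all i ≠ j, (1/λ)(Λ_a − 2Σ_a + S^l + S^u)_{ij} is a subgradient of the absolute value at (Σ_a)_{ij}, and (2Σ_a − S^l − S^u)_{ii} = (Λ_a)_{ii} for all i (for a = 1, 2). Then ⟨Λ₁ − Λ₂, Σ₁ − Σ₂⟩ ≥ 2‖Σ₁ − Σ₂‖²_F. -/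
open Matrix Real

noncomputable section

/-- `g` is a subgradient of the absolute value at `x`. -/
def IsSubgradAbs (g x : ℝ) : Prop := ∀ y : ℝ, |x| + g * (y - x) ≤ |y|

/-- Stationarity conditions for a pair `(Σ, Λ)` of symmetric matrices. -/
def Stationary {p : ℕ} (Sl Su : Matrix (Fin p) (Fin p) ℝ) (lam : ℝ)
    (Sig Lam : Matrix (Fin p) (Fin p) ℝ) : Prop :=
  (∀ i j, i ≠ j →
    IsSubgradAbs ((1 / lam) * ((Lam - (2 : ℝ) • Sig + Sl + Su) i j)) (Sig i j)) ∧
  (∀ i, ((2 : ℝ) • Sig - Sl - Su) i i = Lam i i)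

/-- The subdifferential of the absolute value is a monotone operator. -/
theorem IsSubgradAbs.mul_sub_nonneg {g₁ g₂ x₁ x₂ : ℝ}
    (h₁ : IsSubgradAbs g₁ x₁) (h₂ : IsSubgradAbs g₂ x₂) :
    0 ≤ (g₁ - g₂) * (x₁ - x₂) := by
  linarith [h₁ x₂, h₂ x₁]

/-- Entrywise form of the monotonicity of the stationarity conditions. -/
theorem Stationary.two_mul_sq_sub_le {p : ℕ} {Sl Su : Matrix (Fin p) (Fin p) ℝ} {lam : ℝ}
    (hlam : 0 < lam) {Sig1 Lam1 Sig2 Lam2 : Matrix (Fin p) (Fin p) ℝ}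
    (h1 : Stationary Sl Su lam Sig1 Lam1) (h2 : Stationary Sl Su lam Sig2 Lam2) (i j : Fin p) :
    2 * (Sig1 i j - Sig2 i j) ^ 2 ≤ (Lam1 i j - Lam2 i j) * (Sig1 i j - Sig2 i j) := by
  obtain rfl | hij := eq_or_ne i j
  · have e1 := h1.2 i
    have e2 := h2.2 i
    simp only [Matrix.sub_apply, Matrix.smul_apply, smul_eq_mul] at e1 e2
    rw [← e1, ← e2]
    exact le_of_eq (by ring)
  · have h := mul_nonneg hlam.le ((h1.1 i j hij).mul_sub_nonneg (h2.1 i j hij))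
    simp only [Matrix.add_apply, Matrix.sub_apply, Matrix.smul_apply, smul_eq_mul] at h
    field_simp at h
    linarith

/-- Monotonicity of the stationarity conditions:
`⟨Λ₁ − Λ₂, Σ₁ − Σ₂⟩ ≥ 2‖Σ₁ − Σ₂‖²_F`. -/
theorem stationarity_monotone {p : ℕ} (Sl Su : Matrix (Fin p) (Fin p) ℝ)
    (hSl : Sl.IsSymm) (hSu : Su.IsSymm) (lam : ℝ) (hlam : 0 < lam)
    (Sig1 Lam1 Sig2 Lam2 : Matrix (Fin p) (Fin p) ℝ)
    (hSig1 : Sig1.IsSymm) (hLam1 : Lam1.IsSymm) (hSig2 : Sig2.IsSymm) (hLam2 : Lam2.IsSymm)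
    (h1 : Stationary Sl Su lam Sig1 Lam1) (h2 : Stationary Sl Su lam Sig2 Lam2) :
    2 * frobNormSq (Sig1 - Sig2) ≤ frobInner (Lam1 - Lam2) (Sig1 - Sig2) := by
  simp only [frobNormSq, frobInner, Finset.mul_sum, Matrix.sub_apply]
  exact Finset.sum_le_sum fun i _ => Finset.sum_le_sum fun j _ =>
    h1.two_mul_sq_sub_le hlam h2 i j

end
end

section
/- Let V and W be real random variables on a probability space with E[exp(tV²)] ≤ K₂ and E[exp(tW²)] ≤ K₂ for all 0 ≤ t ≤ η, where η > 0 and K₂ ≥ 1. Let σ ≥ 0 and let t₁ > 0 satisfy t₁ ≤ η. Then E[(VW)² exp((t₁/2)|VW − σ|)] ≤ exp((t₁/2)σ) · 4 t₁^{−2} · K₂. -/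
open MeasureTheory

/-- For `a ≥ 0`, the square of `a` is dominated by `exp a`. -/
lemma sq_le_exp_of_nonneg {a : ℝ} (ha : 0 ≤ a) : a ^ 2 ≤ Real.exp a := by
  have h1 : a / 4 + 1 ≤ Real.exp (a / 4) := Real.add_one_le_exp _
  have h2 : Real.exp a = (Real.exp (a / 4) ^ 2) ^ 2 := by
    rw [← pow_mul, ← Real.exp_nat_mul]
    congr 1
    push_cast
    ring
  rw [h2]
  have h3 : (a / 4 + 1) ^ 2 ≤ Real.exp (a / 4) ^ 2 := by gcongr
  have h4 : a ≤ Real.exp (a / 4) ^ 2 := by nlinarith [sq_nonneg (a / 4 - 1)]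
  gcongr

/-- Arithmetic-geometric mean bound for the exponential of a product. -/
lemma exp_mul_abs_mul_le {t : ℝ} (ht : 0 ≤ t) (v w : ℝ) :
    Real.exp (t * |v * w|) ≤ (Real.exp (t * v ^ 2) + Real.exp (t * w ^ 2)) / 2 := by
  have hsq (x : ℝ) : Real.exp (t * x ^ 2) = Real.exp (t * x ^ 2 / 2) ^ 2 := by
    rw [← Real.exp_nat_mul]
    congr 1
    push_cast
    ring
  have h1 : Real.exp (t * |v * w|) ≤ Real.exp (t * v ^ 2 / 2) * Real.exp (t * w ^ 2 / 2) := by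
    rw [← Real.exp_add, Real.exp_le_exp, abs_mul, ← sq_abs v, ← sq_abs w]
    nlinarith [mul_nonneg ht (sq_nonneg (|v| - |w|))]
  rw [hsq v, hsq w]
  nlinarith [sq_nonneg (Real.exp (t * v ^ 2 / 2) - Real.exp (t * w ^ 2 / 2))]

/-- Pointwise domination of `x² exp((t/2)|x - s|)` by a multiple of `exp(t|x|)`. -/
lemma sq_mul_exp_abs_sub_le {t s : ℝ} (ht : 0 < t) (hs : 0 ≤ s) (x : ℝ) :
    x ^ 2 * Real.exp ((t / 2) * |x - s|) ≤
      Real.exp ((t / 2) * s) * (4 * (t ^ 2)⁻¹) * Real.exp (t * |x|) := by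
  have hx : x ^ 2 ≤ 4 * (t ^ 2)⁻¹ * Real.exp (t / 2 * |x|) := by
    have h := sq_le_exp_of_nonneg (a := t / 2 * |x|) (by positivity)
    calc x ^ 2 = 4 * (t ^ 2)⁻¹ * (t / 2 * |x|) ^ 2 := by
          rw [mul_pow, sq_abs]
          field_simp
          norm_num
      _ ≤ _ := by gcongr
  have hsub : |x - s| ≤ |x| + s := by
    simpa [abs_of_nonneg hs] using abs_sub x s
  calc x ^ 2 * Real.exp ((t / 2) * |x - s|)
      ≤ (4 * (t ^ 2)⁻¹ * Real.exp (t / 2 * |x|)) * Real.exp ((t / 2) * (|x| + s)) := by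
        gcongr
    _ = _ := by
        have : Real.exp (t * |x|) = Real.exp (t / 2 * |x|) * Real.exp (t / 2 * |x|) := by
          rw [← Real.exp_add]
          ring_nf
        rw [mul_add, Real.exp_add, this]
        ring

/-- Bound `Q₂`: `E[(VW)² exp((t₁/2)|VW − σ|)] ≤ exp((t₁/2)σ) · 4 t₁⁻² · K₂`. -/
theorem sq_exp_abs_prod_bound {Ω : Type*} [MeasurableSpace Ω] (P : Measure Ω)
    [IsProbabilityMeasure P] (V W : Ω → ℝ) (hV : Measurable V) (hW : Measurable W)
    (η K2 : ℝ) (hη : 0 < η) (hK2 : 1 ≤ K2)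
    (hVmgf : ∀ t : ℝ, 0 ≤ t → t ≤ η →
      ∫⁻ ω, ENNReal.ofReal (Real.exp (t * (V ω) ^ 2)) ∂P ≤ ENNReal.ofReal K2)
    (hWmgf : ∀ t : ℝ, 0 ≤ t → t ≤ η →
      ∫⁻ ω, ENNReal.ofReal (Real.exp (t * (W ω) ^ 2)) ∂P ≤ ENNReal.ofReal K2)
    (σ t1 : ℝ) (hσ : 0 ≤ σ) (ht1 : 0 < t1) (ht1η : t1 ≤ η) :
    ∫⁻ ω, ENNReal.ofReal ((V ω * W ω) ^ 2 * Real.exp ((t1 / 2) * |V ω * W ω - σ|)) ∂P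
      ≤ ENNReal.ofReal (Real.exp ((t1 / 2) * σ) * (4 * (t1 ^ 2)⁻¹) * K2) := by
  set C : ℝ := Real.exp ((t1 / 2) * σ) * (4 * (t1 ^ 2)⁻¹)
  have hC0 : 0 ≤ C := by positivity
  have hpt (ω : Ω) :
      ENNReal.ofReal ((V ω * W ω) ^ 2 * Real.exp ((t1 / 2) * |V ω * W ω - σ|)) ≤
        ENNReal.ofReal (C / 2) * (ENNReal.ofReal (Real.exp (t1 * V ω ^ 2)) +
          ENNReal.ofReal (Real.exp (t1 * W ω ^ 2))) := by
    rw [← ENNReal.ofReal_add (by positivity) (by positivity),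
      ← ENNReal.ofReal_mul (by positivity)]
    apply ENNReal.ofReal_le_ofReal
    calc _ ≤ C * Real.exp (t1 * |V ω * W ω|) := sq_mul_exp_abs_sub_le ht1 hσ _
      _ ≤ C * ((Real.exp (t1 * V ω ^ 2) + Real.exp (t1 * W ω ^ 2)) / 2) := by
        gcongr
        exact exp_mul_abs_mul_le ht1.le _ _
      _ = _ := by ring
  calc _ ≤ ∫⁻ ω, ENNReal.ofReal (C / 2) * (ENNReal.ofReal (Real.exp (t1 * V ω ^ 2)) +
          ENNReal.ofReal (Real.exp (t1 * W ω ^ 2))) ∂P := lintegral_mono hpt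
    _ = ENNReal.ofReal (C / 2) * (∫⁻ ω, ENNReal.ofReal (Real.exp (t1 * V ω ^ 2)) ∂P +
          ∫⁻ ω, ENNReal.ofReal (Real.exp (t1 * W ω ^ 2)) ∂P) := by
        rw [lintegral_const_mul _ (by fun_prop), lintegral_add_left (by fun_prop)]
    _ ≤ ENNReal.ofReal (C / 2) * (ENNReal.ofReal K2 + ENNReal.ofReal K2) := by
        gcongr
        · exact hVmgf t1 ht1.le ht1η
        · exact hWmgf t1 ht1.le ht1η
    _ = ENNReal.ofReal (C * K2) := by
        rw [← ENNReal.ofReal_add (by positivity) (by positivity),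
          ← ENNReal.ofReal_mul (by positivity)]
        ring_nf
end
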